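/- arXiv:1104.4261 — 4 statements merged into one kernel-verified Lean document; each statement's English description precedes it below -/
import Mathlib

section
/- Let n be an even integer and let d be an odd divisor of n. Then Σ_{i=1}^{n/2−1} c(i, n/d) = 0. -/
open Finset

/-- The Ramanujan sum `c(k, m) = Σ_{1 ≤ a ≤ m, gcd(a,m)=1} exp(2πi·ak/m)`. -/
noncomputable def ramanujanSum (k m : ℕ) : ℂ :=
  ∑ a ∈ (Finset.Icc 1 m).filter (fun a => Nat.gcd a m = 1),
    Complex.exp (2 * Real.pi * Complex.I * a * k / m)

/-- Reflection of a Ramanujan sum of even modulus `2 * k` about an odd multiple of `k / 2`. -/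
theorem ramanujanSum_odd_mul_sub {k d i : ℕ} (hk : 0 < k) (hd : Odd d) (hi : i ≤ d * k) :
    ramanujanSum (d * k - i) (2 * k) = -ramanujanSum i (2 * k) := by
  have hk' : (k : ℂ) ≠ 0 := by exact_mod_cast hk.ne'
  have hlt : ∀ a ∈ (Finset.Icc 1 (2 * k)).filter (fun a => Nat.gcd a (2 * k) = 1),
      a < 2 * k := by
    intro a ha
    simp only [Finset.mem_filter, Finset.mem_Icc] at ha
    refine lt_of_le_of_ne ha.1.2 ?_
    rintro rfl
    have := ha.2
    rw [Nat.gcd_self] at this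
    omega
  have hmem : ∀ a ∈ (Finset.Icc 1 (2 * k)).filter (fun a => Nat.gcd a (2 * k) = 1),
      2 * k - a ∈ (Finset.Icc 1 (2 * k)).filter (fun a => Nat.gcd a (2 * k) = 1) := by
    intro a ha
    have h := hlt a ha
    simp only [Finset.mem_filter, Finset.mem_Icc] at ha ⊢
    refine ⟨by omega, ?_⟩
    rw [Nat.gcd_self_sub_left h.le]
    exact ha.2
  rw [ramanujanSum, ramanujanSum, ← Finset.sum_neg_distrib]
  refine Finset.sum_nbij' (fun a => 2 * k - a) (fun a => 2 * k - a) hmem hmem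
    (fun a ha => by have := hlt a ha; omega) (fun a ha => by have := hlt a ha; omega) ?_
  intro a ha
  have h := hlt a ha
  simp only [Finset.mem_filter] at ha
  have hodd : Odd (a * d) := by
    refine Odd.mul ?_ hd
    exact Nat.coprime_two_right.mp (Nat.Coprime.coprime_mul_right_right ha.2)
  have hleft : (2 * Real.pi * Complex.I * a * (d * k - i : ℕ) / (2 * k : ℕ) : ℂ) =
      (a * d : ℕ) * (Real.pi * Complex.I) + -(2 * Real.pi * Complex.I * a * i / (2 * k : ℕ)) := by
    push_cast [Nat.cast_sub hi]
    field_simp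
    ring
  have hright : (2 * Real.pi * Complex.I * (2 * k - a : ℕ) * i / (2 * k : ℕ) : ℂ) =
      i * (2 * Real.pi * Complex.I) + -(2 * Real.pi * Complex.I * a * i / (2 * k : ℕ)) := by
    push_cast [Nat.cast_sub h.le]
    field_simp
    ring
  rw [hleft, hright, Complex.exp_add, Complex.exp_add, Complex.exp_nat_mul,
    Complex.exp_nat_mul_two_pi_mul_I, Complex.exp_pi_mul_I, hodd.neg_one_pow]
  ring

/-- For even `n` and an odd divisor `d` of `n`, `Σ_{i=1}^{n/2-1} c(i, n/d) = 0`. -/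
theorem ramanujan_sum_odd_divisor (n d : ℕ) (hn : Even n)
    (hdvd : d ∣ n) (hdodd : Odd d) :
    ∑ i ∈ Finset.Icc 1 (n / 2 - 1), ramanujanSum i (n / d) = 0 := by
  obtain ⟨m, rfl⟩ := hdvd
  have hm : Even m := (Nat.even_mul.mp hn).resolve_left (Nat.not_even_iff_odd.mpr hdodd)
  obtain ⟨k, rfl⟩ := hm.two_dvd
  rcases Nat.eq_zero_or_pos k with rfl | hk
  · simp
  rw [Nat.mul_div_cancel_left _ hdodd.pos, Nat.mul_left_comm d 2 k,
    Nat.mul_div_cancel_left _ two_pos, ← self_eq_neg, ← Finset.sum_neg_distrib]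
  have hmem : ∀ i ∈ Finset.Icc 1 (d * k - 1), d * k - i ∈ Finset.Icc 1 (d * k - 1) := by
    intro i hi
    rw [Finset.mem_Icc] at hi ⊢
    omega
  have hle : ∀ i ∈ Finset.Icc 1 (d * k - 1), i ≤ d * k := by
    intro i hi
    rw [Finset.mem_Icc] at hi
    omega
  refine Finset.sum_nbij' (fun i => d * k - i) (fun i => d * k - i) hmem hmem
    (fun i hi => Nat.sub_sub_self (hle i hi)) (fun i hi => Nat.sub_sub_self (hle i hi)) ?_
  intro i hi
  rw [ramanujanSum_odd_mul_sub hk hdodd (hle i hi), neg_neg]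
end

section
/- Let n be an even integer and let d be a proper divisor of n (d | n, 1 ≤ d < n). Then c(n/2, n/d) = (−1)^d · φ(n/d). Consequently, for any set D of proper divisors of n, the eigenvalue λ_{n/2} of ICG_n(D) equals Σ_{d∈D} (−1)^d φ(n/d). -/
open Finset

theorem card_filter_Icc_gcd_eq_one (m : ℕ) :
    #{a ∈ Finset.Icc 1 m | Nat.gcd a m = 1} = Nat.totient m := by
  rw [← Nat.filter_coprime_Ico_eq_totient m 1]
  congr 1
  ext a
  simp only [Finset.mem_filter, Finset.mem_Icc, Finset.mem_Ico, Nat.coprime_iff_gcd_eq_one,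
    Nat.gcd_comm m a]
  omega

theorem exp_half_eq_neg_one_pow {a d m h : ℕ} (hm : m ≠ 0) (hdm : d * m = 2 * h) :
    Complex.exp (2 * Real.pi * Complex.I * a * h / m) = (-1 : ℂ) ^ (a * d) := by
  have hm' : (m : ℂ) ≠ 0 := by exact_mod_cast hm
  have hdm' : (d : ℂ) * m = 2 * h := by exact_mod_cast hdm
  rw [← Complex.exp_pi_mul_I, ← Complex.exp_nat_mul]
  congr 1
  rw [div_eq_iff hm']
  push_cast
  linear_combination (-(Real.pi * Complex.I * a : ℂ)) * hdm'

theorem neg_one_pow_mul_eq_of_gcd_eq_one {a d m : ℕ} (hdm : Even (d * m))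
    (ha : Nat.gcd a m = 1) : (-1 : ℂ) ^ (a * d) = (-1) ^ d := by
  rcases Nat.even_or_odd d with hd | hd
  · rw [(hd.mul_left a).neg_one_pow, hd.neg_one_pow]
  · have hm : Even m := (Nat.even_mul.mp hdm).resolve_left (Nat.not_even_iff_odd.mpr hd)
    have ha' : Odd a :=
      Nat.coprime_two_right.mp (Nat.Coprime.coprime_dvd_right hm.two_dvd ha)
    rw [(ha'.mul hd).neg_one_pow, hd.neg_one_pow]

theorem ramanujanSum_half {n d : ℕ} (hn : Even n) (hn0 : n ≠ 0) (hd : d ∣ n) :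
    ramanujanSum (n / 2) (n / d) = (-1 : ℂ) ^ d * (Nat.totient (n / d) : ℂ) := by
  have hdm : d * (n / d) = n := Nat.mul_div_cancel' hd
  have hm : n / d ≠ 0 := fun h => hn0 (by rw [← hdm, h, mul_zero])
  have hh : d * (n / d) = 2 * (n / 2) := by rw [hdm, Nat.two_mul_div_two_of_even hn]
  rw [ramanujanSum, Finset.sum_congr rfl (g := fun _ => (-1 : ℂ) ^ d)]
  · rw [Finset.sum_const, card_filter_Icc_gcd_eq_one, nsmul_eq_mul, mul_comm]
  · intro a ha
    rw [exp_half_eq_neg_one_pow hm hh]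
    exact neg_one_pow_mul_eq_of_gcd_eq_one (hdm.symm ▸ hn) (Finset.mem_filter.mp ha).2

/-- For even `n` and a proper divisor `d` of `n`, `c(n/2, n/d) = (-1)^d φ(n/d)`;
consequently `λ_{n/2} = Σ_{d ∈ D} (-1)^d φ(n/d)` for any set `D` of proper divisors. -/
theorem ramanujan_at_half (n : ℕ) (hn : Even n) (hn2 : 2 ≤ n) :
    (∀ d : ℕ, d ∣ n → 1 ≤ d → d < n →
      ramanujanSum (n / 2) (n / d) = (-1 : ℂ) ^ d * (Nat.totient (n / d) : ℂ)) ∧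
    (∀ D : Finset ℕ, (∀ d ∈ D, d ∣ n ∧ 1 ≤ d ∧ d < n) →
      ∑ d ∈ D, ramanujanSum (n / 2) (n / d)
        = ∑ d ∈ D, (-1 : ℂ) ^ d * (Nat.totient (n / d) : ℂ)) := by
  have h (d : ℕ) (hd : d ∣ n) := ramanujanSum_half hn (by omega : n ≠ 0) hd
  exact ⟨fun d hd _ _ => h d hd, fun D hD => Finset.sum_congr rfl fun d hd => h d (hD d hd).1⟩
end

section
/- Let n be a square-free positive integer and let {p_i, p_j} and {p_r, p_q} be two distinct two-element sets of primes dividing n. Then the integral circulant graphs ICG_n({p_i, p_j}) and ICG_n({p_r, p_q}) are not cospectral: the multisets of their adjacency eigenvalues (λ_k = c(k, n/p_i) + c(k, n/p_j) and μ_k = c(k, n/p_r) + c(k, n/p_q), k = 0,…,n−1) are different. Equivalently, if two such graphs over the same square-free n with two-element divisor sets consisting of primes are cospectral, then their divisor sets coincide. -/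
open Finset

lemma ramanujanSum_eq_sum_range (k m : ℕ) (hm : m ≠ 0) :
    ramanujanSum k m = ∑ a ∈ (Finset.range m).filter (fun a => Nat.gcd a m = 1),
      Complex.exp (2 * Real.pi * Complex.I * a * k / m) := by
  have hm' : (m : ℂ) ≠ 0 := by exact_mod_cast hm
  unfold ramanujanSum
  rw [Finset.sum_filter, Finset.sum_filter, ← Finset.Ico_add_one_right_eq_Icc,
    Finset.sum_Ico_eq_sum_range, Nat.add_sub_cancel]
  obtain ⟨l, rfl⟩ := Nat.exists_eq_succ_of_ne_zero hm
  rw [Finset.sum_range_succ, Finset.sum_range_succ']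
  congr 1
  · refine Finset.sum_congr rfl fun a _ => ?_
    rw [add_comm 1 a]
  · have h : Complex.exp (2 * Real.pi * Complex.I * ((1 + l : ℕ) : ℂ) * k / (l.succ : ℕ)) = 1 := by
      rw [Complex.exp_eq_one_iff]
      refine ⟨k, ?_⟩
      rw [add_comm 1 l]
      simp only [Nat.succ_eq_add_one, Int.cast_natCast] at hm' ⊢
      field_simp
    rw [h, add_comm 1 l]
    simp

lemma exp_ramanujan_congr {m a b : ℕ} (hm : m ≠ 0) (k : ℕ) (h : a ≡ b [MOD m]) :
    Complex.exp (2 * Real.pi * Complex.I * a * k / m)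
      = Complex.exp (2 * Real.pi * Complex.I * b * k / m) := by
  have hm' : (m : ℂ) ≠ 0 := by exact_mod_cast hm
  obtain ⟨c, hc⟩ := (Nat.modEq_iff_dvd.mp h)
  have hc' : (b : ℂ) = a + m * c := by
    have : (b : ℤ) = a + m * c := by linarith
    exact_mod_cast this
  rw [Complex.exp_eq_exp_iff_exists_int]
  refine ⟨-c * k, ?_⟩
  rw [hc']
  push_cast
  field_simp
  ring

lemma ramanujanSum_congr {m k l : ℕ} (hm : m ≠ 0) (h : k ≡ l [MOD m]) :
    ramanujanSum k m = ramanujanSum l m := by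
  unfold ramanujanSum
  refine Finset.sum_congr rfl fun a _ => ?_
  have := exp_ramanujan_congr hm a h
  convert this using 2 <;> ring

lemma ramanujanSum_mul {a b : ℕ} (ha : a ≠ 0) (hb : b ≠ 0) (hab : Nat.Coprime a b) (k : ℕ) :
    ramanujanSum k (a * b) = ramanujanSum k a * ramanujanSum k b := by
  have ha' : (a : ℂ) ≠ 0 := by exact_mod_cast ha
  have hb' : (b : ℂ) ≠ 0 := by exact_mod_cast hb
  have hab0 : a * b ≠ 0 := mul_ne_zero ha hb
  rw [ramanujanSum_eq_sum_range _ _ hab0, ramanujanSum_eq_sum_range _ _ ha,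
    ramanujanSum_eq_sum_range _ _ hb, Finset.sum_mul_sum, ← Finset.sum_product']
  symm
  have card_eq (m : ℕ) : #((Finset.range m).filter (fun a => Nat.gcd a m = 1)) = m.totient := by
    rw [Nat.totient_eq_card_coprime]
    congr 1
    ext x
    simp [Nat.Coprime, Nat.gcd_comm]
  set s := (Finset.range a).filter (fun x => Nat.gcd x a = 1) ×ˢ
    (Finset.range b).filter (fun x => Nat.gcd x b = 1) with hs
  set t := (Finset.range (a * b)).filter (fun x => Nat.gcd x (a * b) = 1) with ht
  let f : ℕ × ℕ → ℕ := fun p => (p.1 * b + p.2 * a) % (a * b)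
  have hmaps : Set.MapsTo f s t := by
    rintro ⟨u, v⟩ huv
    simp only [hs, ht, Finset.coe_product, Finset.coe_filter, Finset.mem_range, Set.mem_prod,
      Set.mem_ofPred_eq, f] at huv ⊢
    obtain ⟨⟨_, hu⟩, _, hv⟩ := huv
    refine ⟨Nat.mod_lt _ (Nat.pos_of_ne_zero hab0), ?_⟩
    rw [← Nat.gcd_rec, Nat.gcd_comm]
    refine Nat.Coprime.mul_right ?_ ?_
    · rw [Nat.coprime_add_mul_right_left]
      exact Nat.Coprime.mul_left hu hab.symm
    · rw [add_comm, Nat.coprime_add_mul_right_left]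
      exact Nat.Coprime.mul_left hv hab
  have hinj : Set.InjOn f s := by
    rintro ⟨u, v⟩ huv ⟨u', v'⟩ huv' h
    simp only [hs, Finset.coe_product, Finset.coe_filter, Finset.mem_range, Set.mem_prod,
      Set.mem_ofPred_eq, f] at huv huv' h
    have h' : u * b + v * a ≡ u' * b + v' * a [MOD a * b] := h
    have h1 : u * b ≡ u' * b [MOD a] := by
      have := h'.of_mul_right b
      simpa [Nat.ModEq] using this
    have h2 : v * a ≡ v' * a [MOD b] := by
      have := h'.of_mul_left a
      simpa [Nat.ModEq] using this
    have h3 := Nat.ModEq.cancel_right_of_coprime hab h1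
    have h4 := Nat.ModEq.cancel_right_of_coprime hab.symm h2
    exact Prod.ext (h3.eq_of_lt_of_lt huv.1.1 huv'.1.1) (h4.eq_of_lt_of_lt huv.2.1 huv'.2.1)
  have hsurj : Set.SurjOn f s t := by
    refine Finset.surjOn_of_injOn_of_card_le f hmaps hinj ?_
    rw [hs, ht, Finset.card_product, card_eq, card_eq, card_eq, Nat.totient_mul hab]
  refine Finset.sum_nbij f hmaps hinj hsurj ?_
  rintro ⟨u, v⟩ _
  rw [exp_ramanujan_congr hab0 k (Nat.mod_modEq (u * b + v * a) (a * b)), ← Complex.exp_add]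
  congr 1
  push_cast
  field_simp

lemma sum_range_mul_of_periodic {R : Type*} [CommSemiring R] {a b : ℕ} (ha : a ≠ 0) (hb : b ≠ 0)
    (hab : Nat.Coprime a b) (f g : ℕ → R) (hf : ∀ k l, k ≡ l [MOD a] → f k = f l)
    (hg : ∀ k l, k ≡ l [MOD b] → g k = g l) :
    ∑ k ∈ Finset.range (a * b), f k * g k
      = (∑ k ∈ Finset.range a, f k) * ∑ k ∈ Finset.range b, g k := by
  rw [Finset.sum_mul_sum, ← Finset.sum_product']
  let e : ℕ → ℕ × ℕ := fun k => (k % a, k % b)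
  have hmaps : Set.MapsTo e (Finset.range (a * b)) (Finset.range a ×ˢ Finset.range b :
      Finset (ℕ × ℕ)) := by
    intro k _
    simp [e, Nat.mod_lt _ (Nat.pos_of_ne_zero ha), Nat.mod_lt _ (Nat.pos_of_ne_zero hb)]
  have hinj : Set.InjOn e (Finset.range (a * b)) := by
    intro k hk l hl h
    simp only [e, Prod.mk.injEq] at h
    have := (Nat.modEq_and_modEq_iff_modEq_mul hab).mp h
    exact this.eq_of_lt_of_lt (by simpa using hk) (by simpa using hl)
  refine Finset.sum_nbij e hmaps hinj
    (Finset.surjOn_of_injOn_of_card_le e hmaps hinj (by simp)) fun k _ => ?_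
  rw [hf k _ (Nat.mod_modEq k a).symm, hg k _ (Nat.mod_modEq k b).symm]

lemma ramanujanSum_zero_prime {p : ℕ} (hp : p.Prime) : ramanujanSum 0 p = p - 1 := by
  rw [ramanujanSum_eq_sum_range _ _ hp.ne_zero]
  have h : (Finset.range p).filter (fun a => Nat.gcd a p = 1)
      = (Finset.range p).filter p.Coprime := by
    ext x
    simp [Nat.Coprime, Nat.gcd_comm]
  simp [h, ← Nat.totient_eq_card_coprime, Nat.totient_prime hp, hp.one_le]

lemma ramanujanSum_prime_of_not_dvd {p k : ℕ} (hp : p.Prime) (hk : ¬ p ∣ k) :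
    ramanujanSum k p = -1 := by
  rw [ramanujanSum_eq_sum_range _ _ hp.ne_zero]
  have hp' : (p : ℂ) ≠ 0 := by exact_mod_cast hp.ne_zero
  have h : (Finset.range p).filter (fun a => Nat.gcd a p = 1) = (Finset.range p).erase 0 := by
    ext x
    simp only [Finset.mem_filter, Finset.mem_range, Finset.mem_erase]
    constructor
    · rintro ⟨h1, h2⟩
      refine ⟨?_, h1⟩
      rintro rfl
      exact hp.one_lt.ne' (by simpa using h2)
    · rintro ⟨h1, h2⟩
      exact ⟨h2, (Nat.coprime_of_lt_prime h1 h2 hp).symm⟩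
  rw [h]
  have hz := Finset.add_sum_erase (Finset.range p)
    (fun a : ℕ => Complex.exp (2 * Real.pi * Complex.I * a * k / p)) (a := 0)
    (by simpa using hp.pos)
  have hpow (a : ℕ) : Complex.exp (2 * Real.pi * Complex.I * a * k / p)
      = Complex.exp (2 * Real.pi * Complex.I * k / p) ^ a := by
    rw [← Complex.exp_nat_mul]
    congr 1
    ring
  have hne : Complex.exp (2 * Real.pi * Complex.I * k / p) ≠ 1 := by
    rw [Ne, Complex.exp_eq_one_iff]
    rintro ⟨c, hc⟩
    apply hk
    have : (k : ℂ) = p * c := by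
      have h2 := Complex.two_pi_I_ne_zero
      field_simp at hc
      linear_combination hc
    have : (k : ℤ) = p * c := by exact_mod_cast this
    exact Int.natCast_dvd_natCast.mp ⟨c, this⟩
  have hgeom : ∑ a ∈ Finset.range p, Complex.exp (2 * Real.pi * Complex.I * a * k / p) = 0 := by
    simp_rw [hpow]
    rw [geom_sum_eq hne, ← hpow, Complex.exp_eq_one_iff.mpr ⟨k, by field_simp; simp⟩]
    simp
  rw [hgeom] at hz
  simp only [Nat.cast_zero, mul_zero, zero_mul, zero_div, Complex.exp_zero] at hz
  linear_combination hz

/-- The `j`-th power sum of the Ramanujan sums `c(k, m)` for `0 ≤ k < m`. -/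
noncomputable def ramanujanMoment (j m : ℕ) : ℂ :=
  ∑ k ∈ Finset.range m, ramanujanSum k m ^ j

lemma ramanujanMoment_mul (j : ℕ) {a b : ℕ} (ha : a ≠ 0) (hb : b ≠ 0) (hab : Nat.Coprime a b) :
    ramanujanMoment j (a * b) = ramanujanMoment j a * ramanujanMoment j b := by
  unfold ramanujanMoment
  simp_rw [ramanujanSum_mul ha hb hab, mul_pow]
  exact sum_range_mul_of_periodic ha hb hab _ _ (fun k l h => by rw [ramanujanSum_congr ha h])
    (fun k l h => by rw [ramanujanSum_congr hb h])

lemma ramanujanMoment_prime (j : ℕ) {x : ℕ} (hp : (x + 1).Prime) :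
    ramanujanMoment j (x + 1) = (x : ℂ) ^ j + x * (-1) ^ j := by
  unfold ramanujanMoment
  rw [Finset.sum_range_succ', ramanujanSum_zero_prime hp]
  rw [Finset.sum_congr rfl (g := fun _ => (-1 : ℂ) ^ j)]
  · simp [add_comm]
  · intro k hk
    rw [ramanujanSum_prime_of_not_dvd hp]
    intro h
    have := Nat.le_of_dvd (Nat.succ_pos k) h
    simp at hk
    omega

lemma ramanujanMoment_ne_zero {j : ℕ} (hj : Even j) {n : ℕ} (hn : Squarefree n) :
    ramanujanMoment j n ≠ 0 := by
  induction n using induction_on_primes with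
  | zero => simp at hn
  | one => simp [ramanujanMoment, ramanujanSum]
  | prime_mul p a hp ih =>
    have hc := Nat.coprime_of_squarefree_mul hn
    have ha : a ≠ 0 := by
      rintro rfl
      simp at hn
    rw [ramanujanMoment_mul j hp.ne_zero ha hc]
    refine mul_ne_zero ?_ (ih hn.of_mul_right)
    obtain ⟨x, rfl⟩ := Nat.exists_eq_succ_of_ne_zero hp.ne_zero
    rw [ramanujanMoment_prime j hp, hj.neg_one_pow]
    have : 0 < x := by have := hp.two_le; omega
    have : 0 < x ^ j + x := by positivity
    have h0 : x ^ j + x * 1 ≠ 0 := by omega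
    exact_mod_cast h0

/-- The `j`-th spectral moment of `ICG_n({p, q})` with `n = M p q`. -/
lemma sum_icg_pow (j : ℕ) {M p q : ℕ} (hM : M ≠ 0) (hp : p ≠ 0) (hq : q ≠ 0)
    (hMp : M.Coprime p) (hMq : M.Coprime q) (hpq : p.Coprime q) :
    ∑ k ∈ Finset.range (M * (p * q)), (ramanujanSum k (M * q) + ramanujanSum k (M * p)) ^ j
      = ramanujanMoment j M * ∑ i ∈ Finset.range (j + 1),
          ramanujanMoment i p * ramanujanMoment (j - i) q * (j.choose i : ℂ) := by
  simp_rw [ramanujanSum_mul hM hq hMq, ramanujanSum_mul hM hp hMp, ← mul_add, mul_pow]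
  have hpq0 : p * q ≠ 0 := mul_ne_zero hp hq
  have hcongr {m d k l : ℕ} (hd : d ≠ 0) (h : d ∣ m) (hkl : k ≡ l [MOD m]) :
      ramanujanSum k d = ramanujanSum l d := ramanujanSum_congr hd (hkl.of_dvd h)
  rw [sum_range_mul_of_periodic hM hpq0 (hMp.mul_right hMq) (fun k => ramanujanSum k M ^ j)
    (fun k => (ramanujanSum k q + ramanujanSum k p) ^ j)
    (fun k l h => by rw [ramanujanSum_congr hM h])
    (fun k l h => by rw [hcongr hp (dvd_mul_right p q) h, hcongr hq (dvd_mul_left q p) h])]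
  congr 1
  simp_rw [add_comm (ramanujanSum _ q), add_pow]
  rw [Finset.sum_comm]
  refine Finset.sum_congr rfl fun i _ => ?_
  rw [← Finset.sum_mul]
  congr 1
  exact sum_range_mul_of_periodic hp hq hpq _ _ (fun k l h => by rw [ramanujanSum_congr hp h])
    (fun k l h => by rw [ramanujanSum_congr hq h])

/-- The second and fourth spectral moments of `ICG_n({x + 1, y + 1})`, normalised by moments of
Ramanujan sums that depend only on `n`. -/
lemma sum_icg_two_four {n x y : ℕ} (hn : Squarefree n) (hx : (x + 1).Prime) (hy : (y + 1).Prime)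
    (hdx : x + 1 ∣ n) (hdy : y + 1 ∣ n) (hxy : x ≠ y) :
    (∑ k ∈ Finset.range n, (ramanujanSum k (n / (x + 1)) + ramanujanSum k (n / (y + 1))) ^ 2)
        * (x * y) = ramanujanMoment 2 n * (x + y) ∧
    (∑ k ∈ Finset.range n, (ramanujanSum k (n / (x + 1)) + ramanujanSum k (n / (y + 1))) ^ 4)
        * ((x * (x ^ 2 - x + 1)) * (y * (y ^ 2 - y + 1)))
      = ramanujanMoment 4 n
          * (x * (x ^ 2 - x + 1) + y * (y ^ 2 - y + 1) + 6 * x * y) := by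
  have hc : (x + 1).Coprime (y + 1) := (Nat.coprime_primes hx hy).mpr (by omega)
  obtain ⟨M, rfl⟩ := hc.mul_dvd_of_dvd_of_dvd hdx hdy
  rw [mul_comm _ M] at hn ⊢
  have hM : M ≠ 0 := by
    rintro rfl
    simp at hn
  have hMxy := Nat.coprime_of_squarefree_mul hn
  have hMx : M.Coprime (x + 1) := hMxy.coprime_mul_right_right
  have hMy : M.Coprime (y + 1) := hMxy.coprime_mul_left_right
  have e1 : M * ((x + 1) * (y + 1)) / (x + 1) = M * (y + 1) :=
    Nat.div_eq_of_eq_mul_right (Nat.succ_pos x) (by ring)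
  have e2 : M * ((x + 1) * (y + 1)) / (y + 1) = M * (x + 1) :=
    Nat.div_eq_of_eq_mul_right (Nat.succ_pos y) (by ring)
  have hm (j : ℕ) : ramanujanMoment j (M * ((x + 1) * (y + 1)))
      = ramanujanMoment j M * (ramanujanMoment j (x + 1) * ramanujanMoment j (y + 1)) := by
    rw [ramanujanMoment_mul j hM (by positivity) hMxy,
      ramanujanMoment_mul j (by positivity) (by positivity) hc]
  rw [e1, e2, sum_icg_pow 2 hM (by positivity) (by positivity) hMx hMy hc,
    sum_icg_pow 4 hM (by positivity) (by positivity) hMx hMy hc, hm, hm]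
  simp only [Finset.sum_range_succ, Finset.sum_range_zero, ramanujanMoment_prime _ hx,
    ramanujanMoment_prime _ hy]
  norm_num [Nat.choose]
  constructor <;> ring

lemma add_eq_mul_eq {K : Type*} [CommRing K] [IsDomain K] {t s u v : K} (h1 : t + s = u + v)
    (h2 : t * s = u * v) : t = u ∨ t = v := by
  have : (t - u) * (t - v) = 0 := by linear_combination t * h1 - h2
  rcases mul_eq_zero.mp this with h | h
  · exact Or.inl (sub_eq_zero.mp h)
  · exact Or.inr (sub_eq_zero.mp h)

lemma mul_eq_of_fourth_moment_eq {t s u v : ℝ} (ht : 0 < t) (hs : 0 < s) (hu : 0 < u) (hv : 0 < v)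
    (hσ : t + s ≤ 1 / 2) (h1 : t + s = u + v)
    (h : (t ^ 3 * (1 - s + s ^ 2) + s ^ 3 * (1 - t + t ^ 2) + 6 * t ^ 2 * s ^ 2)
          * ((1 - u + u ^ 2) * (1 - v + v ^ 2))
      = (u ^ 3 * (1 - v + v ^ 2) + v ^ 3 * (1 - u + u ^ 2) + 6 * u ^ 2 * v ^ 2)
          * ((1 - t + t ^ 2) * (1 - s + s ^ 2))) : t * s = u * v := by
  obtain ⟨σ, hσ'⟩ : ∃ σ, σ = t + s := ⟨_, rfl⟩
  obtain ⟨a, ha⟩ : ∃ a, a = t * s := ⟨_, rfl⟩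
  obtain ⟨b, hb⟩ : ∃ b, b = u * v := ⟨_, rfl⟩
  have ha0 : 0 < a := by rw [ha]; positivity
  have hb0 : 0 < b := by rw [hb]; positivity
  have ha1 : a ≤ σ ^ 2 / 4 := by rw [ha, hσ']; nlinarith [sq_nonneg (t - s)]
  have hb1 : b ≤ σ ^ 2 / 4 := by rw [hb, hσ', h1]; nlinarith [sq_nonneg (u - v)]
  have key : (a - b) * ((-3 * σ + 2 * σ ^ 2 - σ ^ 3) + (8 - 7 * σ + 7 * σ ^ 2) * (a + b)
      - (8 + 6 * σ) * (a * b)) = 0 := by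
    have hN (t s : ℝ) : t ^ 3 * (1 - s + s ^ 2) + s ^ 3 * (1 - t + t ^ 2) + 6 * t ^ 2 * s ^ 2
        = (t + s) ^ 3 - (3 * (t + s) + (t + s) ^ 2) * (t * s) + (8 + (t + s)) * (t * s) ^ 2 := by
      ring
    have hD (t s : ℝ) : (1 - t + t ^ 2) * (1 - s + s ^ 2)
        = 1 - (t + s) + (t + s) ^ 2 - (1 + (t + s)) * (t * s) + (t * s) ^ 2 := by
      ring
    rw [hN, hD, hN, hD, ← h1, ← hσ', ← ha, ← hb] at h
    linear_combination h
  have hσ0 : 0 < σ := by rw [hσ']; positivity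
  have hσ2 : σ ≤ 1 / 2 := hσ' ▸ hσ
  have hneg : (-3 * σ + 2 * σ ^ 2 - σ ^ 3) + (8 - 7 * σ + 7 * σ ^ 2) * (a + b)
      - (8 + 6 * σ) * (a * b) < 0 := by
    have h2 : (8 - 7 * σ + 7 * σ ^ 2) * (a + b) ≤ (8 - 7 * σ + 7 * σ ^ 2) * (σ ^ 2 / 2) :=
      mul_le_mul_of_nonneg_left (by linarith) (by nlinarith [sq_nonneg σ])
    have h3 : 0 < (8 + 6 * σ) * (a * b) := by positivity
    have h4 : σ * (-3 + 6 * σ - 9 / 2 * σ ^ 2 + 7 / 2 * σ ^ 3) < 0 := by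
      apply mul_neg_of_pos_of_neg hσ0
      have h5 : σ ^ 3 ≤ σ ^ 2 * (1 / 2) := by
        rw [pow_succ]
        exact mul_le_mul_of_nonneg_left hσ2 (sq_nonneg σ)
      have h6 : 0 < σ ^ 2 := by positivity
      linarith
    linarith
  rw [← ha, ← hb]
  rcases mul_eq_zero.mp key with h' | h'
  · linarith
  · exact absurd h' hneg.ne

lemma ne_one_of_second_moment_eq {x y z w : ℕ} (hz : 0 < z) (hw : 0 < w)
    (hxz : x ≠ z) (hxw : x ≠ w) (h : (x + y) * (z * w) = (z + w) * (x * y)) : x ≠ 1 := by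
  rintro rfl
  have hz2 : 2 ≤ z := by omega
  have hw2 : 2 ≤ w := by omega
  obtain ⟨z, rfl⟩ := Nat.exists_eq_add_of_le hz2
  obtain ⟨w, rfl⟩ := Nat.exists_eq_add_of_le hw2
  have : 2 + z + (2 + w) ≤ (2 + z) * (2 + w) := by nlinarith
  nlinarith

lemma ne_two_of_second_moment_eq {x y z w : ℕ} (hz : 4 ≤ z) (hw : 4 ≤ w)
    (h : (x + y) * (z * w) = (z + w) * (x * y)) : x ≠ 2 := by
  rintro rfl
  obtain ⟨z, rfl⟩ := Nat.exists_eq_add_of_le hz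
  obtain ⟨w, rfl⟩ := Nat.exists_eq_add_of_le hw
  have : 2 * (4 + z + (4 + w)) ≤ (4 + z) * (4 + w) := by nlinarith
  nlinarith

lemma four_le_of_prime_succ {x : ℕ} (hx : (x + 1).Prime) (h1 : x ≠ 1) (h2 : x ≠ 2) : 4 ≤ x := by
  have := hx.two_le
  have h3 : x ≠ 3 := by
    rintro rfl
    norm_num at hx
  omega

lemma eq_or_eq_of_moments_eq {x y z w : ℕ} (hx : (x + 1).Prime) (hy : (y + 1).Prime)
    (hz : (z + 1).Prime) (hw : (w + 1).Prime)
    (h2 : ((x : ℝ) + y) * (z * w) = (z + w) * (x * y))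
    (h4 : ((x : ℝ) * (x ^ 2 - x + 1) + y * (y ^ 2 - y + 1) + 6 * x * y)
        * ((z * (z ^ 2 - z + 1)) * (w * (w ^ 2 - w + 1)))
      = (z * (z ^ 2 - z + 1) + w * (w ^ 2 - w + 1) + 6 * z * w)
        * ((x * (x ^ 2 - x + 1)) * (y * (y ^ 2 - y + 1)))) :
    (x = z ∧ y = w) ∨ (x = w ∧ y = z) := by
  have x0 : 0 < x := Nat.succ_lt_succ_iff.mp hx.one_lt
  have y0 : 0 < y := Nat.succ_lt_succ_iff.mp hy.one_lt
  have z0 : 0 < z := Nat.succ_lt_succ_iff.mp hz.one_lt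
  have w0 : 0 < w := Nat.succ_lt_succ_iff.mp hw.one_lt
  have x0' : (0 : ℝ) < x := by exact_mod_cast x0
  have y0' : (0 : ℝ) < y := by exact_mod_cast y0
  have z0' : (0 : ℝ) < z := by exact_mod_cast z0
  have w0' : (0 : ℝ) < w := by exact_mod_cast w0
  have hσ : (x : ℝ)⁻¹ + (y : ℝ)⁻¹ = (z : ℝ)⁻¹ + (w : ℝ)⁻¹ := by
    field_simp
    linear_combination h2
  have fin {a b c d : ℕ} (h : (a : ℝ)⁻¹ + (b : ℝ)⁻¹ = (c : ℝ)⁻¹ + (d : ℝ)⁻¹) (hac : a = c) :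
      b = d := by
    subst hac
    exact_mod_cast inv_injective (add_left_cancel h)
  suffices x = z ∨ x = w by
    rcases this with h | h
    · exact Or.inl ⟨h, fin hσ h⟩
    · exact Or.inr ⟨h, fin (hσ.trans (add_comm _ _)) h⟩
  by_contra! hne
  obtain ⟨hxz, hxw⟩ := hne
  have hyz : y ≠ z := fun h => hxw (fin ((add_comm _ _).trans hσ) h)
  have hyw : y ≠ w := fun h => hxz (fin ((add_comm _ _).trans (hσ.trans (add_comm _ _))) h)
  have hN : (x + y) * (z * w) = (z + w) * (x * y) := by exact_mod_cast h2
  have hN' : (y + x) * (z * w) = (z + w) * (y * x) := by rw [add_comm, hN, mul_comm x]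
  have hM' : (w + z) * (x * y) = (x + y) * (w * z) := by rw [add_comm, ← hN, mul_comm z]
  have x1 := ne_one_of_second_moment_eq z0 w0 hxz hxw hN
  have y1 := ne_one_of_second_moment_eq z0 w0 hyz hyw hN'
  have z1 := ne_one_of_second_moment_eq x0 y0 hxz.symm hyz.symm hN.symm
  have w1 := ne_one_of_second_moment_eq x0 y0 hxw.symm hyw.symm hM'
  have x4 : 4 ≤ x := by
    refine four_le_of_prime_succ hx x1 fun hx2 => ?_
    exact ne_two_of_second_moment_eq (four_le_of_prime_succ hz z1 (by omega))
      (four_le_of_prime_succ hw w1 (by omega)) hN hx2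
  have y4 : 4 ≤ y := by
    refine four_le_of_prime_succ hy y1 fun hy2 => ?_
    exact ne_two_of_second_moment_eq (four_le_of_prime_succ hz z1 (by omega))
      (four_le_of_prime_succ hw w1 (by omega)) hN' hy2
  have hx4 : (x : ℝ)⁻¹ ≤ 4⁻¹ := inv_anti₀ (by norm_num) (by exact_mod_cast x4)
  have hy4 : (y : ℝ)⁻¹ ≤ 4⁻¹ := inv_anti₀ (by norm_num) (by exact_mod_cast y4)
  have hprod : (x : ℝ)⁻¹ * (y : ℝ)⁻¹ = (z : ℝ)⁻¹ * (w : ℝ)⁻¹ := by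
    refine mul_eq_of_fourth_moment_eq (inv_pos.mpr x0') (inv_pos.mpr y0') (inv_pos.mpr z0')
      (inv_pos.mpr w0') (by linarith) hσ ?_
    field_simp
    linear_combination h4
  rcases add_eq_mul_eq hσ hprod with h | h
  · exact hxz (by exact_mod_cast inv_injective h)
  · exact hxw (by exact_mod_cast inv_injective h)

/-- For square-free `n` and two distinct two-element sets of primes dividing `n`,
the graphs `ICG_n({p_i,p_j})` and `ICG_n({p_r,p_q})` are not cospectral:
the multisets of eigenvalues differ. -/
theorem icg_two_primes_not_cospectral (n pi pj pr pq : ℕ) (hn : Squarefree n)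
    (hpi : pi.Prime) (hpj : pj.Prime) (hpr : pr.Prime) (hpq : pq.Prime)
    (hdi : pi ∣ n) (hdj : pj ∣ n) (hdr : pr ∣ n) (hdq : pq ∣ n)
    (hij : pi ≠ pj) (hrq : pr ≠ pq)
    (hne : ({pi, pj} : Finset ℕ) ≠ ({pr, pq} : Finset ℕ)) :
    Multiset.map (fun k => ramanujanSum k (n / pi) + ramanujanSum k (n / pj))
        (Multiset.range n)
      ≠ Multiset.map (fun k => ramanujanSum k (n / pr) + ramanujanSum k (n / pq))
        (Multiset.range n) := by
  intro heq
  obtain ⟨x, rfl⟩ := Nat.exists_eq_add_of_le' hpi.one_le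
  obtain ⟨y, rfl⟩ := Nat.exists_eq_add_of_le' hpj.one_le
  obtain ⟨z, rfl⟩ := Nat.exists_eq_add_of_le' hpr.one_le
  obtain ⟨w, rfl⟩ := Nat.exists_eq_add_of_le' hpq.one_le
  have hxy : x ≠ y := fun h => hij (by rw [h])
  have hzw : z ≠ w := fun h => hrq (by rw [h])
  have hmom (j : ℕ) :
      ∑ k ∈ Finset.range n, (ramanujanSum k (n / (x + 1)) + ramanujanSum k (n / (y + 1))) ^ j
        = ∑ k ∈ Finset.range n,
            (ramanujanSum k (n / (z + 1)) + ramanujanSum k (n / (w + 1))) ^ j := by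
    have := congrArg (fun s => (Multiset.map (fun c : ℂ => c ^ j) s).sum) heq
    simp only [Multiset.map_map] at this
    exact this
  obtain ⟨a2, a4⟩ := sum_icg_two_four hn hpi hpj hdi hdj hxy
  obtain ⟨b2, b4⟩ := sum_icg_two_four hn hpr hpq hdr hdq hzw
  rw [hmom] at a2 a4
  have h2 : ((x : ℂ) + y) * (z * w) = (z + w) * (x * y) := by
    apply mul_left_cancel₀ (ramanujanMoment_ne_zero (j := 2) (by decide) hn)
    linear_combination (x * y : ℂ) * b2 - (z * w : ℂ) * a2
  have h4 : ((x : ℂ) * (x ^ 2 - x + 1) + y * (y ^ 2 - y + 1) + 6 * x * y)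
        * ((z * (z ^ 2 - z + 1)) * (w * (w ^ 2 - w + 1)))
      = (z * (z ^ 2 - z + 1) + w * (w ^ 2 - w + 1) + 6 * z * w)
        * ((x * (x ^ 2 - x + 1)) * (y * (y ^ 2 - y + 1))) := by
    apply mul_left_cancel₀ (ramanujanMoment_ne_zero (j := 4) (by decide) hn)
    linear_combination ((x * (x ^ 2 - x + 1)) * (y * (y ^ 2 - y + 1)) : ℂ) * b4
      - ((z * (z ^ 2 - z + 1)) * (w * (w ^ 2 - w + 1)) : ℂ) * a4
  rcases eq_or_eq_of_moments_eq hpi hpj hpr hpq (by exact_mod_cast h2)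
    (by exact_mod_cast h4) with ⟨rfl, rfl⟩ | ⟨rfl, rfl⟩
  · exact hne rfl
  · exact hne (Finset.pair_comm _ _)
end

section
/- Let n be an even positive integer. Then Σ_{d | n, d odd} φ(n/d) = n/2; moreover Σ_{d | n, d odd} c(n/2, n/d) = −n/2, and for every integer k with 1 ≤ k ≤ n−1 and k ≠ n/2, Σ_{d | n, d odd} c(k, n/d) = 0, where the sums range over all odd divisors d of n. -/
open Finset

theorem sum_odd_divisors_sum_coprime {M : Type*} [AddCommMonoid M] {m : ℕ} (hm : 0 < m)
    (f : ℕ → M) :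
    ∑ d ∈ (m + m).divisors.filter (fun d => Odd d),
      ∑ a ∈ (Icc 1 ((m + m) / d)).filter (fun a => Nat.gcd a ((m + m) / d) = 1), f (d * a)
      = ∑ j ∈ range m, f (2 * j + 1) := by
  rw [Finset.sum_sigma']
  refine Finset.sum_bij (fun x _ => (x.1 * x.2) / 2) ?_ ?_ ?_ ?_
  all_goals
    have key : ∀ x ∈ ((m + m).divisors.filter (fun d => Odd d)).sigma
        (fun d => (Icc 1 ((m + m) / d)).filter (fun a => Nat.gcd a ((m + m) / d) = 1)),
        0 < x.1 ∧ Nat.gcd (x.1 * x.2) (m + m) = x.1 ∧ x.1 * x.2 ≤ m + m ∧ Odd (x.1 * x.2) := by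
      rintro ⟨d, a⟩ hx
      simp only [mem_sigma, mem_filter, Nat.mem_divisors, mem_Icc] at hx
      obtain ⟨⟨⟨⟨e, he⟩, hn⟩, hd⟩, ⟨ha, hae⟩, hg⟩ := hx
      have hd0 : 0 < d := hd.pos
      rw [he, Nat.mul_div_cancel_left e hd0] at hg hae
      have hgcd : Nat.gcd (d * a) (m + m) = d := by rw [he, Nat.gcd_mul_left, hg, mul_one]
      refine ⟨hd0, hgcd, he ▸ Nat.mul_le_mul_left d hae, ?_⟩
      by_contra h
      rw [Nat.not_odd_iff_even, even_iff_two_dvd] at h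
      have h2 : 2 ∣ d := hgcd ▸ Nat.dvd_gcd h ⟨m, by ring⟩
      exact (Nat.not_even_iff_odd.2 hd) (even_iff_two_dvd.2 h2)
  · intro x hx
    obtain ⟨-, -, hle, c, hc⟩ := key x hx
    simp only [mem_range]
    omega
  · intro x hx y hy hxy
    obtain ⟨hx0, hxg, -, c, hc⟩ := key x hx
    obtain ⟨-, hyg, -, e, he⟩ := key y hy
    have hmul : x.1 * x.2 = y.1 * y.2 := by
      omega
    have h1 : x.1 = y.1 := by rw [← hxg, ← hyg, hmul]
    have h2 : x.2 = y.2 := by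
      rw [← h1] at hmul
      exact Nat.eq_of_mul_eq_mul_left hx0 hmul
    exact Sigma.ext h1 (heq_of_eq h2)
  · intro j hj
    rw [mem_range] at hj
    have hg0 : 0 < Nat.gcd (2 * j + 1) (m + m) := Nat.gcd_pos_of_pos_left _ (by omega)
    have hdvd := Nat.gcd_dvd_left (2 * j + 1) (m + m)
    refine ⟨⟨Nat.gcd (2 * j + 1) (m + m), (2 * j + 1) / Nat.gcd (2 * j + 1) (m + m)⟩, ?_, ?_⟩
    · simp only [mem_sigma, mem_filter, Nat.mem_divisors, mem_Icc]
      refine ⟨⟨⟨Nat.gcd_dvd_right _ _, by omega⟩, ?_⟩, ⟨?_, ?_⟩, ?_⟩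
      · exact Odd.of_dvd_nat (odd_two_mul_add_one j) hdvd
      · exact Nat.div_pos (Nat.le_of_dvd (by omega) hdvd) hg0
      · exact Nat.div_le_div_right (by omega)
      · exact Nat.coprime_div_gcd_div_gcd hg0
    · dsimp only
      rw [Nat.mul_div_cancel' hdvd]
      omega
  · intro x hx
    obtain ⟨-, -, -, c, hc⟩ := key x hx
    congr 1
    omega

theorem sum_odd_divisors_ramanujanSum {m : ℕ} (hm : 0 < m) (k : ℕ) :
    ∑ d ∈ (m + m).divisors.filter (fun d => Odd d), ramanujanSum k ((m + m) / d)
      = ∑ j ∈ range m, Complex.exp (Real.pi * Complex.I * k / m) ^ (2 * j + 1) := by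
  rw [← sum_odd_divisors_sum_coprime hm (fun b => Complex.exp (Real.pi * Complex.I * k / m) ^ b)]
  refine sum_congr rfl fun d hd => sum_congr rfl fun a _ => ?_
  simp only [mem_filter, Nat.mem_divisors] at hd
  obtain ⟨⟨⟨e, he⟩, hn⟩, hodd⟩ := hd
  have hd0 : (d : ℂ) ≠ 0 := Nat.cast_ne_zero.2 hodd.pos.ne'
  have he0 : (e : ℂ) ≠ 0 := by
    rintro h
    rw [Nat.cast_eq_zero] at h
    simp [h] at he
    omega
  have hm0 : (m : ℂ) ≠ 0 := Nat.cast_ne_zero.2 hm.ne'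
  have hcast : (m : ℂ) + m = d * e := by exact_mod_cast he
  rw [← Complex.exp_nat_mul, he, Nat.mul_div_cancel_left e hodd.pos]
  congr 1
  push_cast
  field_simp
  linear_combination (a : ℂ) * k * hcast

theorem totient_eq_card_Icc (m : ℕ) :
    Nat.totient m = #((Icc 1 m).filter (fun a => Nat.gcd a m = 1)) := by
  rw [← Nat.filter_coprime_Ico_eq_totient m 1]
  congr 1
  ext a
  simp only [mem_filter, mem_Ico, mem_Icc, Nat.coprime_comm (m := m), Nat.Coprime]
  omega

/-- For even `n > 0`: `Σ_{d ∣ n, d odd} φ(n/d) = n/2`,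
`Σ_{d ∣ n, d odd} c(n/2, n/d) = -n/2`, and `Σ_{d ∣ n, d odd} c(k, n/d) = 0`
for all `1 ≤ k ≤ n-1` with `k ≠ n/2`. -/
theorem odd_divisor_sums (n : ℕ) (hpos : 0 < n) (heven : Even n) :
    (∑ d ∈ n.divisors.filter (fun d => Odd d), Nat.totient (n / d) = n / 2) ∧
    (∑ d ∈ n.divisors.filter (fun d => Odd d), ramanujanSum (n / 2) (n / d)
        = -((n / 2 : ℕ) : ℂ)) ∧
    (∀ k : ℕ, 1 ≤ k → k ≤ n - 1 → k ≠ n / 2 →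
      ∑ d ∈ n.divisors.filter (fun d => Odd d), ramanujanSum k (n / d) = 0) := by
  obtain ⟨m, rfl⟩ := heven
  have hm : 0 < m := by omega
  have hm0 : (m : ℂ) ≠ 0 := Nat.cast_ne_zero.2 hm.ne'
  have hhalf : (m + m) / 2 = m := by omega
  rw [hhalf]
  refine ⟨?_, ?_, fun k hk1 hkn hkm => ?_⟩
  · simpa [totient_eq_card_Icc] using sum_odd_divisors_sum_coprime hm (fun _ => (1 : ℕ))
  · rw [sum_odd_divisors_ramanujanSum hm, mul_div_cancel_right₀ _ hm0, Complex.exp_pi_mul_I]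
    simp [pow_succ, pow_mul]
  · rw [sum_odd_divisors_ramanujanSum hm]
    set z := Complex.exp (Real.pi * Complex.I * k / m) with hz
    have hζ := Complex.isPrimitiveRoot_exp m hm.ne'
    have hsq : z ^ 2 = Complex.exp (2 * Real.pi * Complex.I / m) ^ k := by
      rw [hz, ← Complex.exp_nat_mul, ← Complex.exp_nat_mul]
      congr 1
      push_cast
      ring
    have hne : z ^ 2 ≠ 1 := by
      rw [hsq, Ne, hζ.pow_eq_one_iff_dvd]
      rintro ⟨c, rfl⟩
      have hc : c < 2 := by
        by_contra! h
        have := Nat.mul_le_mul_left m h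
        omega
      interval_cases c <;> omega
    have hpow : (z ^ 2) ^ m = 1 := by
      rw [hsq, pow_right_comm, hζ.pow_eq_one, one_pow]
    simp_rw [pow_add, pow_mul]
    rw [← Finset.sum_mul, geom_sum_eq hne, hpow]
    simp
end
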